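/- In U, for all 1 ≤ i, j ≤ N with i ≠ j one has the supercommutator identities [χ_i⁺, K_j𝓔_j] = 0 and [χ_i⁻, Ω(𝓔_j)K_j^{−1}] = 0; explicitly, χ_i⁺(K_j𝓔_j) = (−1)^{[α_i][α_j]}(K_j𝓔_j)χ_i⁺ and χ_i⁻(Ω(𝓔_j)K_j^{−1}) = (−1)^{[α_i][α_j]}(Ω(𝓔_j)K_j^{−1})χ_i⁻. -/

import Mathlib

noncomputable section

open Finset

/-- The base field `K = ℂ(v)`, with `v = q^{1/2}`. -/
abbrev KK : Type := RatFunc ℂ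

/-- The variable `v = q^{1/2}`; thus `q^{a} = vv ^ (2*a)`. -/
def vv : KK := RatFunc.X

/-- `(ε_{k+1}, ε_{k+1})` for `0 ≤ k < N` (0-indexed). -/
def epsSq (n k : ℕ) : ℤ := if k < n then -1 else 1

/-- coefficient of `ε_{k+1}` (0-indexed `k`) in the simple root `α_i`, `0 ≤ i ≤ m+n`. -/
def co (m n i k : ℕ) : ℤ :=
  if i = 0 then (if k = 0 then -2 else 0)
  else if i = m + n then (if k + 1 = m + n then 1 else 0)
  else (if k + 1 = i then 1 else 0) - (if k = i then 1 else 0)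

/-- `(α_i, α_j)`. -/
def Bmat (m n i j : ℕ) : ℤ :=
  ∑ k ∈ Finset.range (m + n), epsSq n k * co m n i k * co m n j k

/-- Bilinear form on weights written in the `α`-basis (coords `ℕ → ℤ`). -/
def Bw (m n : ℕ) (a b : ℕ → ℤ) : ℤ :=
  ∑ i ∈ Finset.range (m + n + 1), ∑ j ∈ Finset.range (m + n + 1), a i * b j * Bmat m n i j

/-- the weight `α_i` in `α`-coordinates. -/
def uw (i : ℕ) : ℕ → ℤ := fun j => if j = i then 1 else 0

/-- the sign `(-1)^{[a][b]}`: the parity of a weight `a` is `a n mod 2`. -/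
def sg (n : ℕ) (a b : ℕ → ℤ) : KK := (-1 : KK) ^ (a n * b n)

/-- the coefficient `(-1)^{[a][b]} q^{-(a,b)}` appearing in `⟦·,·⟧`. -/
def qcf (m n : ℕ) (a b : ℕ → ℤ) : KK := sg n a b * vv ^ (-2 * Bw m n a b)

/-- `q_i = vv ^ qexp i`. -/
def qexp (m n i : ℕ) : ℤ := if Bmat m n i i = 0 then 2 else |Bmat m n i i|

/-- the quantum integer `[a]_i`. -/
def qint (m n i : ℕ) (a : ℤ) : KK :=
  (vv ^ (qexp m n i * a) - vv ^ (-(qexp m n i * a))) / (vv ^ qexp m n i - vv ^ (-qexp m n i))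

/-- the matrix `A_{ij}`. -/
def Amat (m n i j : ℕ) : ℤ := if i = m + n then 2 * Bmat m n i j else Bmat m n i j

section brackets
variable {A : Type*} [Ring A] [Algebra KK A]

/-- `[x, y]_c = x y - c • (y x)`. -/
def cbr (c : KK) (x y : A) : A := x * y - c • (y * x)

/-- supercommutator of homogeneous elements of weights `a`, `b`. -/
def sbr (n : ℕ) (a b : ℕ → ℤ) (x y : A) : A := cbr (sg n a b) x y

/-- the bracket `⟦x, y⟧` for homogeneous elements of weights `a`, `b`. -/
def qbr (m n : ℕ) (a b : ℕ → ℤ) (x y : A) : A := cbr (qcf m n a b) x y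

end brackets

/-- total weight of a list of simple-root indices. -/
def lwt (l : List ℕ) : ℕ → ℤ := l.foldr (fun j w => uw j + w) 0

/-- right-nested `⟦·,⟦·,…⟧⟧` of a list of simple root vectors `e j`. -/
def qfoldr (m n : ℕ) {A : Type*} [Ring A] [Algebra KK A] (e : ℕ → A) : List ℕ → A
  | [] => 1
  | [j] => e j
  | j :: rest => qbr m n (uw j) (lwt rest) (e j) (qfoldr m n e rest)

/-! ## The Drinfeld–Jimbo presentation `U = U_q[osp(2m+1|2n)^{(1)}]` -/

/-- Generators of `U`. -/
inductive UGen (m n : ℕ) : Type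
  | cp (i : Fin (m + n + 1))   -- χ_i⁺
  | cm (i : Fin (m + n + 1))   -- χ_i⁻
  | kk (i : Fin (m + n + 1))   -- K_i
  | ki (i : Fin (m + n + 1))   -- K_i⁻¹
  | kd                          -- K_δ^{1/2}
  | kdi                         -- K_δ^{-1/2}

/-- Free algebra on the generators of `U`. -/
abbrev UF (m n : ℕ) : Type := FreeAlgebra KK (UGen m n)

def uidx (m n : ℕ) (i : ℕ) : Fin (m + n + 1) := ⟨i % (m + n + 1), Nat.mod_lt _ (Nat.succ_pos _)⟩

def fcp (m n : ℕ) (i : ℕ) : UF m n := FreeAlgebra.ι KK (UGen.cp (uidx m n i))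
def fcm (m n : ℕ) (i : ℕ) : UF m n := FreeAlgebra.ι KK (UGen.cm (uidx m n i))
def fk (m n : ℕ) (i : ℕ) : UF m n := FreeAlgebra.ι KK (UGen.kk (uidx m n i))
def fki (m n : ℕ) (i : ℕ) : UF m n := FreeAlgebra.ι KK (UGen.ki (uidx m n i))
def fkd (m n : ℕ) : UF m n := FreeAlgebra.ι KK (UGen.kd)
def fkdi (m n : ℕ) : UF m n := FreeAlgebra.ι KK (UGen.kdi)
/-- `χ_i^σ`, `σ = true` for `+`. -/
def fx (m n : ℕ) (σ : Bool) (i : ℕ) : UF m n := if σ then fcp m n i else fcm m n i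

/-- left-hand side of DJ9. -/
def dj9lhs (m n : ℕ) (σ : Bool) : UF m n :=
  sbr n (uw 3 + uw 2 + uw 1 + uw 0 + uw 1 + uw 2) (uw 1)
   (qbr m n (uw 3 + uw 2 + uw 1 + uw 0 + uw 1) (uw 2)
    (qbr m n (uw 3 + uw 2 + uw 1 + uw 0) (uw 1)
     (qbr m n (uw 3 + uw 2 + uw 1) (uw 0)
      (qbr m n (uw 3 + uw 2) (uw 1)
       (qbr m n (uw 3) (uw 2) (fx m n σ 3) (fx m n σ 2))
       (fx m n σ 1))
      (fx m n σ 0))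
     (fx m n σ 1))
    (fx m n σ 2))
   (fx m n σ 1)

/-- `⟦χ_2^σ, χ_1^σ⟧`. -/
def dj10A (m n : ℕ) (σ : Bool) : UF m n := qbr m n (uw 2) (uw 1) (fx m n σ 2) (fx m n σ 1)

/-- left-hand side of DJ10. -/
def dj10lhs (m n : ℕ) (σ : Bool) : UF m n :=
  qbr m n (uw 2 + uw 1) ((uw 2 + uw 1) + ((uw 2 + uw 1) + uw 0)) (dj10A m n σ)
   (qbr m n (uw 2 + uw 1) ((uw 2 + uw 1) + uw 0) (dj10A m n σ)
    (qbr m n (uw 2 + uw 1) (uw 0) (dj10A m n σ) (fx m n σ 0)))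

/-- right-hand side of DJ10 (without the scalar). -/
def dj10rhs (m n : ℕ) (σ : Bool) : UF m n :=
  qbr m n ((uw 2 + uw 1) + (uw 2 + (uw 2 + (uw 1 + uw 0)))) (uw 1)
   (qbr m n (uw 2 + uw 1) (uw 2 + (uw 2 + (uw 1 + uw 0))) (dj10A m n σ)
    (qbr m n (uw 2) (uw 2 + (uw 1 + uw 0)) (fx m n σ 2)
     (qbr m n (uw 2) (uw 1 + uw 0) (fx m n σ 2)
      (qbr m n (uw 1) (uw 0) (fx m n σ 1) (fx m n σ 0)))))
   (fx m n σ 1)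

/-- The defining relations (DJ1)–(DJ11) of `U_q[osp(2m+1|2n)^{(1)}]`. -/
inductive URel (m n : ℕ) : UF m n → UF m n → Prop
  | k_inv (i : ℕ) (hi : i ≤ m + n) : URel m n (fk m n i * fki m n i) 1
  | inv_k (i : ℕ) (hi : i ≤ m + n) : URel m n (fki m n i * fk m n i) 1
  | k_k (i j : ℕ) (hi : i ≤ m + n) (hj : j ≤ m + n) :
      URel m n (fk m n i * fk m n j) (fk m n j * fk m n i)
  | k_x (σ : Bool) (i j : ℕ) (hi : i ≤ m + n) (hj : j ≤ m + n) :
      URel m n (fk m n i * fx m n σ j * fki m n i)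
           ((vv ^ ((if σ then 2 else -2) * Bmat m n i j)) • fx m n σ j)
  | xp_xm (i j : ℕ) (hi : i ≤ m + n) (hj : j ≤ m + n) :
      URel m n (sbr n (uw i) (uw j) (fcp m n i) (fcm m n j))
           (if i = j then (vv ^ qexp m n i - vv ^ (-qexp m n i))⁻¹ • (fk m n i - fki m n i) else 0)
  | x_x (σ : Bool) (i j : ℕ) (hi : i ≤ m + n) (hj : j ≤ m + n) (h0 : Bmat m n i j = 0) :
      URel m n (sbr n (uw i) (uw j) (fx m n σ i) (fx m n σ j)) 0
  | serre_up (σ : Bool) (i : ℕ) (hi : i < m + n) (hn : i ≠ n) :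
      URel m n (qbr m n (uw i) (uw i + uw (i+1)) (fx m n σ i)
             (qbr m n (uw i) (uw (i+1)) (fx m n σ i) (fx m n σ (i+1)))) 0
  | serre_dn (σ : Bool) (i : ℕ) (h1 : 1 < i) (hi : i < m + n) (hn : i ≠ n) :
      URel m n (qbr m n (uw i) (uw i + uw (i-1)) (fx m n σ i)
             (qbr m n (uw i) (uw (i-1)) (fx m n σ i) (fx m n σ (i-1)))) 0
  | serre3 (σ : Bool) (i : ℕ) (hi : i = 1 ∨ i = m + n) :
      URel m n (qbr m n (uw i) (uw i + (uw i + uw (i-1))) (fx m n σ i)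
             (qbr m n (uw i) (uw i + uw (i-1)) (fx m n σ i)
               (qbr m n (uw i) (uw (i-1)) (fx m n σ i) (fx m n σ (i-1))))) 0
  | serre4 (σ : Bool) (hn : 1 < n) :
      URel m n (sbr n (uw (n-1) + uw n + uw (n+1)) (uw n)
             (qbr m n (uw (n-1) + uw n) (uw (n+1))
               (qbr m n (uw (n-1)) (uw n) (fx m n σ (n-1)) (fx m n σ n)) (fx m n σ (n+1)))
             (fx m n σ n)) 0
  | serre5 (σ : Bool) (hn : n = 1) (hm : 2 ≤ m) : URel m n (dj9lhs m n σ) 0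
  | serre6 (σ : Bool) (hn : n = 1) (hm : m = 1) :
      URel m n (dj10lhs m n σ) ((1 - qint m n 1 2) • dj10rhs m n σ)
  | kd_inv : URel m n (fkd m n * fkdi m n) 1
  | inv_kd : URel m n (fkdi m n * fkd m n) 1
  | kd_sq : URel m n (fkd m n * fkd m n)
      (fk m n 0 * ((List.range (m + n)).map (fun i => fk m n (i+1) * fk m n (i+1))).prod)
  | kd_c (y : UGen m n) : URel m n (fkd m n * FreeAlgebra.ι KK y) (FreeAlgebra.ι KK y * fkd m n)
  | kdi_c (y : UGen m n) : URel m n (fkdi m n * FreeAlgebra.ι KK y) (FreeAlgebra.ι KK y * fkdi m n)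

/-- The Drinfeld–Jimbo quantum affine superalgebra `U_q[osp(2m+1|2n)^{(1)}]`. -/
abbrev UAlg (m n : ℕ) : Type := RingQuot (URel m n)

def mkU (m n : ℕ) : UF m n →ₐ[KK] UAlg m n := RingQuot.mkAlgHom KK (URel m n)

def cp (m n : ℕ) (i : ℕ) : UAlg m n := mkU m n (fcp m n i)
def cm (m n : ℕ) (i : ℕ) : UAlg m n := mkU m n (fcm m n i)
def kU (m n : ℕ) (i : ℕ) : UAlg m n := mkU m n (fk m n i)
def kiU (m n : ℕ) (i : ℕ) : UAlg m n := mkU m n (fki m n i)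
def kdU (m n : ℕ) : UAlg m n := mkU m n (fkd m n)
def kdiU (m n : ℕ) : UAlg m n := mkU m n (fkdi m n)

/-- the index sequence of the quantum root vector `𝓔_i`:
`1, …, î, …, N, N, N-1, …, 1, 0`. -/
def eseq (m n i : ℕ) : List ℕ :=
  (((List.range (m + n)).map (· + 1)).filter (· ≠ i)) ++
    ((List.range (m + n)).map (· + 1)).reverse ++ [0]

/-- the quantum root vector `𝓔_i` (of weight `δ - α_i`). -/
def EE (m n i : ℕ) : UAlg m n := qfoldr m n (cp m n) (eseq m n i)

/-- `d_{i}` for `1 ≤ i ≤ N+1`: `(ε_i,ε_i)` for `i ≤ N`, and `d_{N+1} = 1`. -/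
def dd (n i : ℕ) : ℤ := if 1 ≤ i ∧ i ≤ n then -1 else 1

/-- The specification of the anti-automorphism `Ω` (together with the companion field
homomorphism `τ : f(v) ↦ f(v⁻¹)` of `ℂ(v)`). -/
def OmegaSpec (m n : ℕ) (τ : KK →+* KK) (Ω : UAlg m n → UAlg m n) : Prop :=
  (∀ c : ℂ, τ (algebraMap ℂ KK c) = algebraMap ℂ KK c) ∧
  τ vv = vv⁻¹ ∧
  Function.Bijective Ω ∧
  (∀ x y : UAlg m n, Ω (x + y) = Ω x + Ω y) ∧
  (∀ x y : UAlg m n, Ω (x * y) = Ω y * Ω x) ∧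
  (∀ (f : KK) (x : UAlg m n), Ω (f • x) = τ f • Ω x) ∧
  (∀ i ≤ m + n, Ω (cp m n i) = ((dd n (i+1) : ℤ) : KK) • cm m n i) ∧
  (∀ i ≤ m + n, Ω (cm m n i) = ((dd n (i+1) : ℤ) : KK) • cp m n i) ∧
  (∀ i ≤ m + n, Ω (kU m n i) = kiU m n i) ∧
  (∀ i ≤ m + n, Ω (kiU m n i) = kU m n i) ∧
  Ω (kdU m n) = kdiU m n ∧
  Ω (kdiU m n) = kdU m n

section identities

variable {K A : Type*} [Field K] [Ring A] [Algebra K A]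

/-- The commutator of `x` and `y` twisted by the scalar `c`. -/
def qcomm (c : K) (x y : A) : A := x * y - c • (y * x)

lemma mul_self_of_qcomm_neg_one {x : A} (h : qcomm (-1 : K) x x = 0) (h2 : (2 : K) ≠ 0) :
    x * x = 0 := by
  rw [qcomm, neg_one_smul, sub_neg_eq_add, ← two_smul K] at h
  exact (smul_eq_zero.mp h).resolve_left h2

/-- The quadratic `q`-Serre relation is inherited by the adjoint operators. -/
lemma qcomm_quadratic_serre {x y z : A} {p r s t : K} (hr : r ≠ 0) (hp : p * r = r⁻¹)
    (hS : qcomm (p * r) x (qcomm r x y) = 0) :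
    qcomm (p * (r * s)) x (qcomm (r * s) x (qcomm t y z))
        + qcomm (r * (r * t)) y (qcomm (p * s) x (qcomm s x z))
      = (r + r⁻¹) • qcomm (r * (p * s)) x (qcomm (r * t) y (qcomm s x z)) := by
  have hp' : p = r⁻¹ * r⁻¹ := by field_simp at hp ⊢; exact hp
  subst hp'
  have h3 := congrArg (fun w => w * z - (s * s * t) • (z * w)) hS
  simp only [qcomm, mul_sub, sub_mul, smul_sub, mul_smul_comm, smul_mul_assoc, smul_smul, mul_assoc,
    zero_mul, mul_zero, sub_zero, smul_zero] at h3 ⊢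
  rw [← sub_eq_zero, ← h3]
  match_scalars <;> field_simp <;> ring

/-- The cubic `q`-Serre relation is inherited by the adjoint operators. -/
lemma qcomm_cubic_serre {x y z : A} {p r s t : K} (hr : r ≠ 0) (hp : p * r = 1)
    (hS : qcomm (p * (p * r)) x (qcomm (p * r) x (qcomm r x y)) = 0) :
    qcomm (p * (p * (r * s))) x (qcomm (p * (r * s)) x (qcomm (r * s) x (qcomm t y z)))
        + (1 + r + r⁻¹) • qcomm (r * (p * (p * s))) x
            (qcomm (r * (r * t)) y (qcomm (p * s) x (qcomm s x z)))
      = (1 + r + r⁻¹) • qcomm (p * (r * (p * s))) x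
            (qcomm (r * (p * s)) x (qcomm (r * t) y (qcomm s x z)))
        + qcomm (r * (r * (r * t))) y (qcomm (p * (p * s)) x (qcomm (p * s) x (qcomm s x z))) := by
  have hp' : p = r⁻¹ := by field_simp at hp ⊢; exact hp
  subst hp'
  have h3 := congrArg (fun w => w * z - (s * s * s * t) • (z * w)) hS
  simp only [qcomm, mul_sub, sub_mul, smul_sub, mul_smul_comm, smul_mul_assoc, smul_smul, mul_assoc,
    zero_mul, mul_zero, sub_zero, smul_zero] at h3 ⊢
  rw [← sub_eq_zero, ← h3]
  match_scalars <;> field_simp <;> ring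

/-- The quartic Serre relation at an isotropic root is inherited by the adjoint operators. -/
lemma qcomm_quartic_serre {a b c z : A} {r s t u : K} (hr : r ≠ 0)
    (hac : a * c = c * a) (hbb : b * b = 0)
    (hS : qcomm (-1 : K) (qcomm r⁻¹ (qcomm r a b) c) b = 0) :
    qcomm (r * (r * s)) a (qcomm (r⁻¹ * (-1 * t)) b (qcomm (r⁻¹ * u) c (qcomm t b z)))
        + qcomm (r⁻¹ * (r⁻¹ * u)) c (qcomm (r * (-1 * t)) b (qcomm (r * s) a (qcomm t b z)))
        + qcomm (r * (-1 * (r⁻¹ * t))) b (qcomm (r * s) a (qcomm (r⁻¹ * t) b (qcomm u c z)))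
        + qcomm (r⁻¹ * (-1 * (r * t))) b (qcomm (r⁻¹ * u) c (qcomm (r * t) b (qcomm s a z)))
      = (r + r⁻¹) • qcomm (r * (r⁻¹ * (-1 * t))) b
          (qcomm (r * s) a (qcomm (r⁻¹ * u) c (qcomm t b z))) := by
  have hbb' (w : A) : b * (b * w) = 0 := by rw [← mul_assoc, hbb, zero_mul]
  have hac' (w : A) : a * (c * w) = c * (a * w) := by rw [← mul_assoc, hac, mul_assoc]
  have h3 := congrArg (fun w => w * z - (s * t * t * u) • (z * w)) hS
  simp only [qcomm, mul_sub, sub_mul, smul_sub, mul_smul_comm, smul_mul_assoc, smul_smul, mul_assoc,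
    neg_mul, mul_neg, smul_neg, zero_sub, zero_mul, mul_zero, sub_zero, hbb, hbb', hac, hac',
    smul_zero] at h3 ⊢
  rw [← sub_eq_zero, ← h3]
  match_scalars <;> field_simp <;> ring

end identities

section form

variable {m n : ℕ}

lemma co_eq {i k : ℕ} (hi : 1 ≤ i) (hk : k < m + n) :
    co m n i k = (if i = k + 1 then 1 else 0) - (if i = k then 1 else 0) := by
  unfold co
  split_ifs <;> omega

lemma Bmat_eq (i j : ℕ) (hi : i < m + n) :
    Bmat m n (i + 1) j = epsSq n i * co m n j i
      - if i + 1 < m + n then epsSq n (i + 1) * co m n j (i + 1) else 0 := by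
  have h (k : ℕ) (hk : k ∈ range (m + n)) : epsSq n k * co m n (i + 1) k * co m n j k
      = (if i = k then epsSq n k * co m n j k else 0)
        - if i + 1 = k then epsSq n k * co m n j k else 0 := by
    rw [co_eq (by omega) (mem_range.mp hk)]
    simp only [Nat.add_right_cancel_iff]
    split_ifs <;> ring
  rw [Bmat, sum_congr rfl h, sum_sub_distrib, sum_ite_eq, sum_ite_eq]
  simp [hi]

lemma Bmat_comm (i j : ℕ) : Bmat m n i j = Bmat m n j i :=
  sum_congr rfl fun _ _ => by ring

lemma Bmat_of_far {i j : ℕ} (hij : i + 2 ≤ j) (hj : j ≤ m + n) : Bmat m n j i = 0 := by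
  obtain _ | j := j
  · omega
  rw [Bmat_eq _ _ hj]
  unfold co epsSq
  split_ifs <;> (try norm_num) <;> omega

lemma Bmat_odd (hm : 1 ≤ m) (hn : 1 ≤ n) : Bmat m n n n = 0 := by
  obtain _ | n := n
  · omega
  rw [Bmat_eq _ _ (by omega)]
  unfold co epsSq
  split_ifs <;> (try norm_num) <;> omega

lemma Bmat_succ {i : ℕ} (hi : 1 ≤ i) (hiN : i < m + n) :
    Bmat m n (i + 1) i = -epsSq n i := by
  rw [Bmat_eq _ _ hiN]
  unfold co epsSq
  split_ifs <;> (try norm_num) <;> omega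

lemma Bmat_self {i : ℕ} (hi : i + 1 < m + n) (hn : i + 1 ≠ n) :
    Bmat m n (i + 1) (i + 1) = 2 * epsSq n i := by
  rw [Bmat_eq _ _ (by omega)]
  unfold co epsSq
  split_ifs <;> (try norm_num) <;> omega

lemma Bmat_last {i : ℕ} (hm : 1 ≤ m) (hi : i + 1 = m + n) :
    Bmat m n (i + 1) (i + 1) = 1 := by
  rw [Bmat_eq _ _ (by omega)]
  unfold co epsSq
  split_ifs <;> (try norm_num) <;> omega

lemma epsSq_succ {i : ℕ} (hn : i + 1 ≠ n) : epsSq n (i + 1) = epsSq n i := by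
  unfold epsSq
  split_ifs <;> omega

lemma Bw_add_right (a b c : ℕ → ℤ) : Bw m n a (b + c) = Bw m n a b + Bw m n a c := by
  simp only [Bw, Pi.add_apply, mul_add, add_mul, sum_add_distrib]

lemma Bw_add_left (a b c : ℕ → ℤ) : Bw m n (a + b) c = Bw m n a c + Bw m n b c := by
  simp only [Bw, Pi.add_apply, add_mul, sum_add_distrib]

lemma Bw_uw {i j : ℕ} (hi : i ≤ m + n) (hj : j ≤ m + n) :
    Bw m n (uw i) (uw j) = Bmat m n i j := by
  simp [Bw, uw, sum_ite_eq', hi, hj]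

lemma sg_uw {i j : ℕ} (h : ¬(i = n ∧ j = n)) : sg n (uw i) (uw j) = 1 := by
  unfold sg uw
  split_ifs <;> simp_all

lemma vv_ne_zero : vv ≠ 0 := RatFunc.X_ne_zero

lemma qcf_add_right (a b c : ℕ → ℤ) : qcf m n a (b + c) = qcf m n a b * qcf m n a c := by
  rw [qcf, Bw_add_right, sg, Pi.add_apply, mul_add, mul_add, zpow_add₀ vv_ne_zero,
    zpow_add₀ (by norm_num), qcf, qcf, sg, sg]
  ring

lemma qcf_add_left (a b c : ℕ → ℤ) : qcf m n (a + b) c = qcf m n a c * qcf m n b c := by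
  rw [qcf, Bw_add_left, sg, Pi.add_apply, add_mul, mul_add, zpow_add₀ vv_ne_zero,
    zpow_add₀ (by norm_num), qcf, qcf, sg, sg]
  ring

lemma qcf_comm (a b : ℕ → ℤ) : qcf m n a b = qcf m n b a := by
  have h : Bw m n a b = Bw m n b a := by
    rw [Bw, sum_comm]
    exact sum_congr rfl fun i _ => sum_congr rfl fun j _ => by rw [Bmat_comm]; ring
  rw [qcf, h, sg, mul_comm (a n), qcf, sg]

lemma qcf_uw {i j : ℕ} (hi : i ≤ m + n) (hj : j ≤ m + n) (h : ¬(i = n ∧ j = n)) :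
    qcf m n (uw i) (uw j) = vv ^ (-2 * Bmat m n i j) := by
  rw [qcf, sg_uw h, one_mul, Bw_uw hi hj]

lemma qcf_uw_odd (hm : 1 ≤ m) (hn : 1 ≤ n) : qcf m n (uw n) (uw n) = -1 := by
  rw [qcf, Bw_uw (by omega) (by omega), Bmat_odd hm hn]
  simp [sg, uw]

lemma qcf_ne_zero (a b : ℕ → ℤ) : qcf m n a b ≠ 0 :=
  mul_ne_zero (zpow_ne_zero _ (by norm_num)) (zpow_ne_zero _ vv_ne_zero)

open Polynomial in
/-- A polynomial in `v` with nonzero constant term is nonzero. -/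
lemma polynomial_vv_ne_zero {f : ℂ[X]} (hf : f.eval 0 ≠ 0) : algebraMap ℂ[X] KK f ≠ 0 := by
  intro h
  rw [map_eq_zero_iff _ (RatFunc.algebraMap_injective ℂ)] at h
  simp [h] at hf

open Polynomial in
lemma quantum_two_ne {r : KK} (hr : r = vv ^ 2 ∨ r = (vv ^ 2)⁻¹) :
    r + r⁻¹ ≠ 0 ∧ (r + r⁻¹) * (r + r⁻¹) ≠ 1 ∧ 1 + r + r⁻¹ ≠ 0 := by
  have hv := vv_ne_zero
  have h1 := polynomial_vv_ne_zero (f := X ^ 4 + 1) (by simp)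
  have h2 := polynomial_vv_ne_zero (f := X ^ 4 + X ^ 2 + 1) (by simp)
  have h3 := polynomial_vv_ne_zero (f := X ^ 4 - X ^ 2 + 1) (by simp)
  simp only [map_add, map_sub, map_pow, map_one, RatFunc.algebraMap_X] at h1 h2 h3
  change vv ^ 4 + 1 ≠ 0 at h1
  change vv ^ 4 + vv ^ 2 + 1 ≠ 0 at h2
  change vv ^ 4 - vv ^ 2 + 1 ≠ 0 at h3
  have e : r + r⁻¹ = (vv ^ 4 + 1) / vv ^ 2 := by
    obtain rfl | rfl := hr <;> field_simp
    ring
  rw [add_assoc, e]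
  refine ⟨div_ne_zero h1 (pow_ne_zero _ hv), fun h => ?_, fun h => ?_⟩
  · field_simp at h
    exact mul_ne_zero h2 h3 (by linear_combination h)
  · field_simp at h
    exact h2 (by linear_combination h)

end form

/-- Operators `L₁, …, L_{M+1}` satisfying the Serre relations of the finite type diagram with odd
node `n`, together with a vector `v` that generates the adjoint module of the affine node. -/
structure SerreOperators {K V : Type*} [Field K] [AddCommGroup V] [Module K V] (M n : ℕ)
    (L : ℕ → Module.End K V) (v : V) : Prop where
  comm : ∀ i j x, 1 ≤ i → i + 2 ≤ j → j ≤ M + 1 → L i (L j x) = L j (L i x)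
  odd : ∀ x, L n (L n x) = 0
  up : ∀ i, 1 ≤ i → i ≤ M → i ≠ n → ∃ κ : K, κ ≠ 0 ∧ κ * κ ≠ 1 ∧ ∀ x,
    L i (L i (L (i + 1) x)) + L (i + 1) (L i (L i x)) = κ • L i (L (i + 1) (L i x))
  down : ∀ i, 1 ≤ i → i + 1 ≤ M → i + 1 ≠ n → ∃ κ : K, κ ≠ 0 ∧ ∀ x,
    L (i + 1) (L (i + 1) (L i x)) + L i (L (i + 1) (L (i + 1) x))
      = κ • L (i + 1) (L i (L (i + 1) x))
  cubic : ∃ κ : K, κ ≠ 0 ∧ ∀ x,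
    L (M + 1) (L (M + 1) (L (M + 1) (L M x))) + κ • L (M + 1) (L M (L (M + 1) (L (M + 1) x)))
      = κ • L (M + 1) (L (M + 1) (L M (L (M + 1) x)))
        + L M (L (M + 1) (L (M + 1) (L (M + 1) x)))
  quartic : ∀ k, k + 1 = n → 1 ≤ k → ∃ κ : K, ∀ x,
    L k (L (k + 1) (L (k + 2) (L (k + 1) x))) + L (k + 2) (L (k + 1) (L k (L (k + 1) x)))
        + L (k + 1) (L k (L (k + 1) (L (k + 2) x))) + L (k + 1) (L (k + 2) (L (k + 1) (L k x)))
      = κ • L (k + 1) (L k (L (k + 2) (L (k + 1) x)))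
  lowest : ∀ i, 2 ≤ i → i ≤ M + 1 → L i v = 0
  cubic_lowest : L 1 (L 1 (L 1 v)) = 0

namespace SerreOperators

variable {K V : Type*} [Field K] [AddCommGroup V] [Module K V] {M n : ℕ}
  {L : ℕ → Module.End K V} {v : V}

/-- The vector `L_k ⋯ L_1 v`. -/
def rise (L : ℕ → Module.End K V) (v : V) : ℕ → V
  | 0 => v
  | k + 1 => L (k + 1) (rise L v k)

/-- The vector `L_k L_{k+1} ⋯ L_N L_N ⋯ L_1 v`. -/
def descend (N : ℕ) (L : ℕ → Module.End K V) (v : V) (k : ℕ) : V :=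
  (List.range' k (N + 1 - k)).foldr (fun i x => L i x) (rise L v N)

lemma descend_top (N : ℕ) : descend N L v (N + 1) = rise L v N := by
  simp [descend]

lemma descend_eq {N k : ℕ} (hk : k ≤ N) : descend N L v k = L k (descend N L v (k + 1)) := by
  rw [descend, show N + 1 - k = (N + 1 - (k + 1)) + 1 by omega, List.range'_succ]
  rfl

lemma apply_rise (h : SerreOperators M n L v) (k : ℕ) (hk : k ≤ M + 1) :
    ∀ i, 2 ≤ i → i ≤ M + 1 → i ≠ k + 1 → (i ≤ M ∨ k ≤ M) → L i (rise L v k) = 0 := by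
  induction k using Nat.strong_induction_on with
  | _ k ih =>
    intro i h2 hi hik hM
    obtain _ | k := k
    · exact h.lowest i h2 hi
    have ih1 := ih k (by omega) (by omega)
    simp only [rise]
    obtain h3 | rfl | rfl | h3 : k + 3 ≤ i ∨ i = k + 1 ∨ i = k ∨ i + 1 ≤ k := by omega
    · rw [← h.comm _ _ _ (by omega) (by omega) hi, ih1 i h2 hi (by omega) (by omega), map_zero]
    · by_cases hn : k + 1 = n
      · rw [hn]
        exact h.odd _
      obtain _ | k := k
      · omega
      have ih2 := ih k (by omega) (by omega)
      obtain ⟨κ, hκ, hd⟩ := h.down (k + 1) (by omega) (by omega) hn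
      simpa [rise, ih2 (k + 1 + 1) h2 hi (by omega) (by omega)] using hd (rise L v k)
    · obtain _ | k := i
      · omega
      have ih2 := ih k (by omega) (by omega)
      by_cases hn : k + 1 = n
      · obtain _ | k := k
        · omega
        have ih3 := ih k (by omega) (by omega)
        obtain ⟨κ, hq⟩ := h.quartic (k + 1) hn (by omega)
        simpa [rise, ih3 (k + 1 + 1) h2 hi (by omega) (by omega),
          ih3 (k + 1 + 2) (by omega) (by omega) (by omega) (by omega)] using hq (rise L v k)
      · obtain ⟨κ, hκ, -, hu⟩ := h.up (k + 1) (by omega) (by omega) hn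
        have h4 := ih1 (k + 1) h2 hi (by omega) (by omega)
        have h5 := hu (rise L v k)
        simp only [rise] at h4 ⊢
        rw [ih2 (k + 1 + 1) (by omega) (by omega) (by omega) (by omega), h4] at h5
        simpa [hκ] using h5.symm
    · rw [h.comm _ _ _ (by omega) (by omega) hk, ih1 i h2 hi (by omega) (by omega), map_zero]

lemma apply_descend (h : SerreOperators M n L v) (hM : 1 ≤ M) (d : ℕ) :
    ∀ k, k + d = M + 2 → 2 ≤ k → ∀ i, 2 ≤ i → i ≤ M + 1 → i + 1 ≠ k →
      L i (descend (M + 1) L v k) = 0 := by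
  induction d using Nat.strong_induction_on with
  | _ d ih =>
    intro k hkd hk i h2 hi hik
    obtain _ | d := d
    · obtain rfl : k = M + 1 + 1 := by omega
      rw [descend_top]
      exact h.apply_rise _ le_rfl i h2 hi (by omega) (by omega)
    have ih1 := ih d (by omega) (k + 1) (by omega) (by omega)
    rw [descend_eq (by omega)]
    obtain h3 | rfl | rfl | h3 : i + 2 ≤ k ∨ i = k ∨ i = k + 1 ∨ k + 2 ≤ i := by omega
    · rw [h.comm _ _ _ (by omega) h3 (by omega), ih1 i h2 hi (by omega), map_zero]
    · obtain _ | d := d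
      · obtain rfl : i = M + 1 := by omega
        obtain _ | M := M
        · omega
        obtain ⟨κ, -, hc⟩ := h.cubic
        simpa [descend_top, rise, h.apply_rise M (by omega) (M + 1 + 1) h2 hi (by omega) (by omega)]
          using hc (rise L v M)
      by_cases hn : i = n
      · rw [hn]
        exact h.odd _
      obtain ⟨κ, -, -, hu⟩ := h.up i (by omega) (by omega) hn
      have h4 := hu (descend (M + 1) L v (i + 2))
      rw [ih d (by omega) (i + 2) (by omega) (by omega) i h2 hi (by omega)] at h4
      rw [descend_eq (by omega)]
      simpa using h4
    · obtain _ | d := d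
      · omega
      have ih2 := ih d (by omega) (k + 2) (by omega) (by omega)
      obtain _ | d := d
      · obtain rfl : k = M := by omega
        obtain ⟨κ, hκ, hc⟩ := h.cubic
        have h4 := hc (rise L v k)
        have h5 := h.apply_rise k (by omega) k hk (by omega) (by omega) (by omega)
        have h6 := h.apply_rise (k + 1) (by omega) k hk (by omega) (by omega) (by omega)
        have h7 := ih1 (k + 1) h2 hi (by omega)
        rw [descend_eq le_rfl, descend_top] at h7 ⊢
        simp only [rise] at h6 h7 ⊢
        rw [h5, h6, h7] at h4
        simpa [hκ] using h4
      by_cases hn : k + 1 = n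
      · obtain ⟨κ, hq⟩ := h.quartic k hn (by omega)
        have ih3 := ih d (by omega) (k + 3) (by omega) (by omega)
        have h4 := hq (descend (M + 1) L v (k + 3))
        rw [ih3 (k + 1) h2 hi (by omega), ih3 k hk (by omega) (by omega)] at h4
        rw [descend_eq (by omega), descend_eq (by omega)]
        simpa using h4
      · obtain ⟨κ, hκ, hd⟩ := h.down k (by omega) (by omega) hn
        have h4 := hd (descend (M + 1) L v (k + 2))
        have h5 := ih1 (k + 1) h2 hi (by omega)
        rw [descend_eq (by omega)] at h5 ⊢
        rw [ih2 k hk (by omega) (by omega), h5] at h4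
        simpa [hκ] using h4.symm
    · rw [← h.comm _ _ _ (by omega) h3 hi, ih1 i h2 hi (by omega), map_zero]

lemma sq_apply_rise (h : SerreOperators M n L v) (hn : 1 ≠ n) (k : ℕ) :
    k + 1 ≤ M → L 1 (L 1 (rise L v (k + 2))) = 0 := by
  induction k with
  | zero =>
    intro hM
    obtain ⟨κ, hκ, hκ2, hu⟩ := h.up 1 le_rfl hM hn
    have h1 := hu v
    have h2 := hu (L 1 v)
    rw [h.lowest _ le_rfl (by omega)] at h1
    rw [h.cubic_lowest] at h2
    simp only [map_zero, zero_add, add_zero] at h1 h2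
    rw [h1, map_smul, smul_smul] at h2
    have h3 : (κ * κ - 1) • L 1 (L 1 (L (1 + 1) (L 1 v))) = 0 := by
      rw [sub_smul, one_smul, ← h2, sub_self]
    exact (smul_eq_zero.mp h3).resolve_left (sub_ne_zero.mpr hκ2)
  | succ k ih =>
    intro hM
    have hc (x : V) := h.comm 1 (k + 2 + 1) x le_rfl (by omega) (by omega)
    rw [rise, hc, hc, ih (by omega), map_zero]

lemma sq_apply_descend (h : SerreOperators M n L v) (hM : 1 ≤ M) (d : ℕ) :
    ∀ k, k + d = M + 2 → 3 ≤ k → L 1 (L 1 (descend (M + 1) L v k)) = 0 := by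
  by_cases hn : 1 = n
  · subst hn
    exact fun k _ _ => h.odd _
  induction d with
  | zero =>
    intro k hk h3
    obtain rfl : k = M + 1 + 1 := by omega
    obtain _ | M := M
    · omega
    rw [descend_top]
    exact h.sq_apply_rise hn M (by omega)
  | succ d ih =>
    intro k hk h3
    have hc (x : V) := h.comm 1 k x le_rfl h3 (by omega)
    rw [descend_eq (by omega), hc, hc, ih _ (by omega) (by omega), map_zero]

/-- The vector `L_1 ⋯ L̂_j ⋯ L_N L_N ⋯ L_1 v` is killed by all `L_i` with `i ≠ j`. -/
lemma apply_omit (h : SerreOperators M n L v) (hM : 1 ≤ M) {i j : ℕ} (hi1 : 1 ≤ i)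
    (hi : i ≤ M + 1) (hj1 : 1 ≤ j) (hj : j ≤ M + 1) (hij : i ≠ j) :
    L i ((List.range' 1 (j - 1)).foldr (fun i x => L i x) (descend (M + 1) L v (j + 1))) = 0 := by
  obtain rfl | rfl | ⟨k, rfl⟩ : j = 1 ∨ j = 2 ∨ ∃ k, j = k + 3 := by
    obtain _ | _ | _ | k := j
    · omega
    · exact Or.inl rfl
    · exact Or.inr (Or.inl rfl)
    · exact Or.inr (Or.inr ⟨k, rfl⟩)
  · exact h.apply_descend hM M 2 (by omega) le_rfl i (by omega) hi (by omega)
  · change L i (L 1 (descend (M + 1) L v 3)) = 0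
    obtain rfl | h1 : i = 1 ∨ 3 ≤ i := by omega
    · exact h.sq_apply_descend hM (M - 1) 3 (by omega) le_rfl
    · rw [← h.comm _ _ _ le_rfl h1 hi,
        h.apply_descend hM (M - 1) 3 (by omega) (by omega) i (by omega) hi (by omega), map_zero]
  · have h0 (l : List ℕ) : l.foldr (fun i x => L i x) (0 : V) = 0 := by
      induction l with
      | nil => rfl
      | cons a l ih => simp [ih]
    rw [show k + 3 - 1 = k + 1 + 1 by omega, List.range'_concat, List.foldr_append]
    have h1 := h.apply_descend hM (M - k - 2) (k + 3 + 1) (by omega) (by omega) (k + 2) (by omega)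
      (by omega) (by omega)
    simp only [List.foldr_cons, List.foldr_nil]
    rw [show 1 + 1 * (k + 1) = k + 2 by omega, h1, h0, map_zero]

end SerreOperators

section adjoint

variable {m n : ℕ}

lemma mkU_rel {x y : UF m n} (h : URel m n x y) : mkU m n x = mkU m n y :=
  RingQuot.mkAlgHom_rel KK h

lemma mkU_cbr (c : KK) (x y : UF m n) : mkU m n (cbr c x y) = qcomm c (mkU m n x) (mkU m n y) := by
  simp [cbr, qcomm]

lemma cp_rel {i j : ℕ} (hi : i ≤ m + n) (hj : j ≤ m + n) (h : Bmat m n i j = 0) :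
    qcomm (sg n (uw i) (uw j)) (cp m n i) (cp m n j) = 0 := by
  simpa [sbr, mkU_cbr, fx, cp] using mkU_rel (URel.x_x true i j hi hj h)

lemma cp_comm {i j : ℕ} (hi : i ≤ m + n) (hj : j ≤ m + n) (hij : i ≠ j)
    (h : Bmat m n i j = 0) : cp m n i * cp m n j = cp m n j * cp m n i := by
  have := cp_rel hi hj h
  rwa [sg_uw (by omega), qcomm, one_smul, sub_eq_zero] at this

lemma cp_odd_sq (hm : 1 ≤ m) (hn : 1 ≤ n) : cp m n n * cp m n n = 0 := by
  have := cp_rel (m := m) (n := n) (i := n) (j := n) (by omega) (by omega) (Bmat_odd hm hn)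
  rw [show sg n (uw n) (uw n) = -1 by simp [sg, uw]] at this
  exact mul_self_of_qcomm_neg_one this two_ne_zero

lemma cp_serre_up {i : ℕ} (hi : i < m + n) (hn : i ≠ n) :
    qcomm (qcf m n (uw i) (uw i) * qcf m n (uw i) (uw (i + 1))) (cp m n i)
      (qcomm (qcf m n (uw i) (uw (i + 1))) (cp m n i) (cp m n (i + 1))) = 0 := by
  simpa [qbr, mkU_cbr, fx, cp, qcf_add_right] using mkU_rel (URel.serre_up true i hi hn)

lemma cp_serre_down {i : ℕ} (h1 : 1 ≤ i) (hi : i + 1 < m + n) (hn : i + 1 ≠ n) :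
    qcomm (qcf m n (uw (i + 1)) (uw (i + 1)) * qcf m n (uw (i + 1)) (uw i)) (cp m n (i + 1))
      (qcomm (qcf m n (uw (i + 1)) (uw i)) (cp m n (i + 1)) (cp m n i)) = 0 := by
  simpa [qbr, mkU_cbr, fx, cp, qcf_add_right] using
    mkU_rel (URel.serre_dn true (i + 1) (by omega) hi hn)

lemma cp_serre_cubic {i : ℕ} (hi : i = 0 ∨ i + 1 = m + n) :
    qcomm (qcf m n (uw (i + 1)) (uw (i + 1))
        * (qcf m n (uw (i + 1)) (uw (i + 1)) * qcf m n (uw (i + 1)) (uw i))) (cp m n (i + 1))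
      (qcomm (qcf m n (uw (i + 1)) (uw (i + 1)) * qcf m n (uw (i + 1)) (uw i)) (cp m n (i + 1))
        (qcomm (qcf m n (uw (i + 1)) (uw i)) (cp m n (i + 1)) (cp m n i))) = 0 := by
  simpa [qbr, mkU_cbr, fx, cp, qcf_add_right] using
    mkU_rel (URel.serre3 (m := m) (n := n) true (i + 1) (by omega))

lemma cp_serre_quartic {k : ℕ} (hn : k + 1 = n) (hk : 1 ≤ k) :
    qcomm (-1 : KK) (qcomm (qcf m n (uw k) (uw (k + 2)) * qcf m n (uw (k + 1)) (uw (k + 2)))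
      (qcomm (qcf m n (uw k) (uw (k + 1))) (cp m n k) (cp m n (k + 1))) (cp m n (k + 2)))
      (cp m n (k + 1)) = 0 := by
  subst hn
  have h := mkU_rel (URel.serre4 (m := m) (n := k + 1) true (by omega))
  have hs : sg (k + 1) (uw k + uw (k + 1) + uw (k + 1 + 1)) (uw (k + 1)) = -1 := by
    simp [sg, uw]
  simpa [qbr, sbr, mkU_cbr, fx, cp, qcf_add_left, hs] using h

/-- The `q`-adjoint action of `χ_i⁺` on families of elements indexed by their weights. -/
def adOp (m n i : ℕ) : Module.End KK ((ℕ → ℤ) → UAlg m n) where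
  toFun f w := qcomm (qcf m n (uw i) (w - uw i)) (cp m n i) (f (w - uw i))
  map_add' f g := by
    funext w
    simp only [qcomm, Pi.add_apply, mul_add, add_mul, smul_add]
    abel
  map_smul' c f := by
    funext w
    simp only [qcomm, Pi.smul_apply, mul_smul_comm, smul_mul_assoc, RingHom.id_apply, smul_sub]
    rw [smul_comm]

lemma adOp_one (f : (ℕ → ℤ) → UAlg m n) {i : ℕ} {w u : ℕ → ℤ} (hw : w = uw i + u) :
    adOp m n i f w = qcomm (qcf m n (uw i) u) (cp m n i) (f u) := by
  subst hw
  change qcomm (qcf m n (uw i) (uw i + u - uw i)) (cp m n i) (f (uw i + u - uw i)) = _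
  rw [add_sub_cancel_left]

lemma adOp_two (f : (ℕ → ℤ) → UAlg m n) {i j : ℕ} {w u : ℕ → ℤ} (hw : w = uw i + (uw j + u)) :
    adOp m n i (adOp m n j f) w
      = qcomm (qcf m n (uw i) (uw j) * qcf m n (uw i) u) (cp m n i)
          (qcomm (qcf m n (uw j) u) (cp m n j) (f u)) := by
  rw [adOp_one _ hw, adOp_one _ rfl, qcf_add_right]

lemma adOp_three (f : (ℕ → ℤ) → UAlg m n) {i j k : ℕ} {w u : ℕ → ℤ}
    (hw : w = uw i + (uw j + (uw k + u))) :
    adOp m n i (adOp m n j (adOp m n k f)) w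
      = qcomm (qcf m n (uw i) (uw j) * (qcf m n (uw i) (uw k) * qcf m n (uw i) u)) (cp m n i)
          (qcomm (qcf m n (uw j) (uw k) * qcf m n (uw j) u) (cp m n j)
            (qcomm (qcf m n (uw k) u) (cp m n k) (f u))) := by
  rw [adOp_one _ hw, adOp_two _ rfl, qcf_add_right, qcf_add_right]

lemma adOp_four (f : (ℕ → ℤ) → UAlg m n) {i j k l : ℕ} {w u : ℕ → ℤ}
    (hw : w = uw i + (uw j + (uw k + (uw l + u)))) :
    adOp m n i (adOp m n j (adOp m n k (adOp m n l f))) w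
      = qcomm (qcf m n (uw i) (uw j) * (qcf m n (uw i) (uw k)
            * (qcf m n (uw i) (uw l) * qcf m n (uw i) u))) (cp m n i)
          (qcomm (qcf m n (uw j) (uw k) * (qcf m n (uw j) (uw l) * qcf m n (uw j) u)) (cp m n j)
            (qcomm (qcf m n (uw k) (uw l) * qcf m n (uw k) u) (cp m n k)
              (qcomm (qcf m n (uw l) u) (cp m n l) (f u)))) := by
  rw [adOp_one _ hw, adOp_three _ rfl, qcf_add_right, qcf_add_right, qcf_add_right]

lemma adOp_comm {i j : ℕ} (hi : i ≤ m + n) (hj : j ≤ m + n) (hij : i ≠ j)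
    (h : Bmat m n i j = 0) (f : (ℕ → ℤ) → UAlg m n) :
    adOp m n i (adOp m n j f) = adOp m n j (adOp m n i f) := by
  funext w
  obtain ⟨u, rfl⟩ : ∃ u, w = uw i + (uw j + u) := ⟨w - uw i - uw j, by abel⟩
  have hc := cp_comm hi hj hij h
  have hc' (x : UAlg m n) : cp m n i * (cp m n j * x) = cp m n j * (cp m n i * x) := by
    rw [← mul_assoc, hc, mul_assoc]
  rw [adOp_two f rfl, adOp_two f (u := u) (by abel), qcf_comm (uw j) (uw i),
    qcf_uw hi hj (by omega), h]
  simp only [qcomm, mul_sub, sub_mul, smul_sub, mul_smul_comm, smul_mul_assoc, smul_smul,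
    mul_assoc, hc, hc', mul_zero, zpow_zero, one_mul, mul_comm (qcf m n (uw j) u)]
  abel

lemma adOp_odd_sq (hm : 1 ≤ m) (hn : 1 ≤ n) (f : (ℕ → ℤ) → UAlg m n) :
    adOp m n n (adOp m n n f) = 0 := by
  funext w
  obtain ⟨u, rfl⟩ : ∃ u, w = uw n + (uw n + u) := ⟨w - uw n - uw n, by abel⟩
  have hc := cp_odd_sq hm hn
  have hc' (x : UAlg m n) : cp m n n * (cp m n n * x) = 0 := by
    rw [← mul_assoc, hc, zero_mul]
  rw [adOp_two f rfl, qcf_uw_odd hm hn]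
  simp only [qcomm, mul_sub, sub_mul, smul_sub, mul_smul_comm, smul_mul_assoc,
    mul_assoc, hc, hc', mul_zero, smul_zero, neg_one_mul, neg_smul, Pi.zero_apply]
  abel

lemma adOp_quadratic {i j : ℕ}
    (hp : qcf m n (uw i) (uw i) * qcf m n (uw i) (uw j) = (qcf m n (uw i) (uw j))⁻¹)
    (hS : qcomm (qcf m n (uw i) (uw i) * qcf m n (uw i) (uw j)) (cp m n i)
      (qcomm (qcf m n (uw i) (uw j)) (cp m n i) (cp m n j)) = 0) (f : (ℕ → ℤ) → UAlg m n) :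
    adOp m n i (adOp m n i (adOp m n j f)) + adOp m n j (adOp m n i (adOp m n i f))
      = (qcf m n (uw i) (uw j) + (qcf m n (uw i) (uw j))⁻¹)
          • adOp m n i (adOp m n j (adOp m n i f)) := by
  funext w
  obtain ⟨u, rfl⟩ : ∃ u, w = uw i + (uw i + (uw j + u)) := ⟨w - uw i - uw i - uw j, by abel⟩
  rw [Pi.add_apply, Pi.smul_apply, adOp_three f rfl, adOp_three f (u := u) (by abel),
    adOp_three f (u := u) (by abel), qcf_comm (uw j) (uw i)]
  exact qcomm_quadratic_serre (qcf_ne_zero _ _) hp hS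

lemma adOp_cubic {i j : ℕ} (hp : qcf m n (uw i) (uw i) * qcf m n (uw i) (uw j) = 1)
    (hS : qcomm (qcf m n (uw i) (uw i) * (qcf m n (uw i) (uw i) * qcf m n (uw i) (uw j)))
      (cp m n i) (qcomm (qcf m n (uw i) (uw i) * qcf m n (uw i) (uw j)) (cp m n i)
        (qcomm (qcf m n (uw i) (uw j)) (cp m n i) (cp m n j))) = 0) (f : (ℕ → ℤ) → UAlg m n) :
    adOp m n i (adOp m n i (adOp m n i (adOp m n j f)))
        + (1 + qcf m n (uw i) (uw j) + (qcf m n (uw i) (uw j))⁻¹)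
          • adOp m n i (adOp m n j (adOp m n i (adOp m n i f)))
      = (1 + qcf m n (uw i) (uw j) + (qcf m n (uw i) (uw j))⁻¹)
          • adOp m n i (adOp m n i (adOp m n j (adOp m n i f)))
        + adOp m n j (adOp m n i (adOp m n i (adOp m n i f))) := by
  funext w
  obtain ⟨u, rfl⟩ : ∃ u, w = uw i + (uw i + (uw i + (uw j + u))) :=
    ⟨w - uw i - uw i - uw i - uw j, by abel⟩
  simp only [Pi.add_apply, Pi.smul_apply]
  rw [adOp_four f rfl, adOp_four f (u := u) (by abel), adOp_four f (u := u) (by abel),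
    adOp_four f (u := u) (by abel), qcf_comm (uw j) (uw i)]
  exact qcomm_cubic_serre (qcf_ne_zero _ _) hp hS

lemma adOp_quartic (hm : 1 ≤ m) {k : ℕ} (hn : k + 1 = n) (hk : 1 ≤ k)
    (f : (ℕ → ℤ) → UAlg m n) :
    adOp m n k (adOp m n (k + 1) (adOp m n (k + 2) (adOp m n (k + 1) f)))
        + adOp m n (k + 2) (adOp m n (k + 1) (adOp m n k (adOp m n (k + 1) f)))
        + adOp m n (k + 1) (adOp m n k (adOp m n (k + 1) (adOp m n (k + 2) f)))
        + adOp m n (k + 1) (adOp m n (k + 2) (adOp m n (k + 1) (adOp m n k f)))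
      = (qcf m n (uw k) (uw (k + 1)) + (qcf m n (uw k) (uw (k + 1)))⁻¹)
          • adOp m n (k + 1) (adOp m n k (adOp m n (k + 2) (adOp m n (k + 1) f))) := by
  funext w
  obtain ⟨u, rfl⟩ : ∃ u, w = uw k + (uw (k + 1) + (uw (k + 2) + (uw (k + 1) + u))) :=
    ⟨w - uw k - uw (k + 1) - uw (k + 2) - uw (k + 1), by abel⟩
  have h0 : Bmat m n k (k + 2) = 0 := by rw [Bmat_comm, Bmat_of_far le_rfl (by omega)]
  have hac := qcf_uw (m := m) (n := n) (i := k) (j := k + 2) (by omega) (by omega) (by omega)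
  rw [h0, mul_zero, zpow_zero] at hac
  have hbb : qcf m n (uw (k + 1)) (uw (k + 1)) = -1 := by
    rw [hn]
    exact qcf_uw_odd hm (by omega)
  have hbc : qcf m n (uw (k + 1)) (uw (k + 2)) = (qcf m n (uw k) (uw (k + 1)))⁻¹ := by
    rw [qcf_uw (by omega) (by omega) (by omega), qcf_uw (by omega) (by omega) (by omega),
      Bmat_comm, Bmat_comm k, Bmat_succ (by omega) (by omega), Bmat_succ hk (by omega),
      ← zpow_neg, show epsSq n (k + 1) = 1 by simp [epsSq, hn],
      show epsSq n k = -1 by simp [epsSq, ← hn]]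
    norm_num
  have hS := cp_serre_quartic (m := m) hn hk
  rw [hac, one_mul, hbc] at hS
  simp only [Pi.add_apply, Pi.smul_apply]
  rw [adOp_four f rfl, adOp_four f (u := u) (by abel), adOp_four f (u := u) (by abel),
    adOp_four f (u := u) (by abel), adOp_four f (u := u) (by abel), qcf_comm (uw (k + 1)) (uw k),
    qcf_comm (uw (k + 2)) (uw k), qcf_comm (uw (k + 2)) (uw (k + 1)), hac, hbb, hbc]
  simp only [one_mul]
  have hb2 : cp m n (k + 1) * cp m n (k + 1) = 0 := by
    rw [hn]
    exact cp_odd_sq hm (by omega)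
  simpa only [neg_one_mul] using qcomm_quartic_serre (qcf_ne_zero _ _)
    (cp_comm (by omega) (by omega) (by omega) h0) hb2 hS

open Classical in
lemma adOp_single (i : ℕ) (w : ℕ → ℤ) (y : UAlg m n) :
    adOp m n i (Pi.single w y)
      = Pi.single (uw i + w) (qcomm (qcf m n (uw i) w) (cp m n i) y) := by
  funext u
  obtain ⟨u, rfl⟩ : ∃ t, u = uw i + t := ⟨u - uw i, by abel⟩
  rw [adOp_one _ rfl]
  by_cases h : u = w
  · subst h
    simp
  · rw [Pi.single_eq_of_ne h, Pi.single_eq_of_ne (by simpa using h)]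
    simp [qcomm]

lemma qcf_self_neighbour {i j : ℕ} (hi : i ≤ m + n) (hj : j ≤ m + n) {e : ℤ}
    (he : e = 1 ∨ e = -1) (hii : Bmat m n i i = 2 * e) (hB : Bmat m n i j = -e) (hn : i ≠ n) :
    qcf m n (uw i) (uw i) * qcf m n (uw i) (uw j) = (qcf m n (uw i) (uw j))⁻¹ ∧
      (qcf m n (uw i) (uw j) = vv ^ 2 ∨ qcf m n (uw i) (uw j) = (vv ^ 2)⁻¹) := by
  rw [qcf_uw hi hj (by omega), qcf_uw hi hi (by omega), hii, hB, ← zpow_add₀ vv_ne_zero,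
    ← zpow_neg]
  refine ⟨by ring_nf, ?_⟩
  obtain rfl | rfl := he
  · exact Or.inl (by norm_num)
  · exact Or.inr (by norm_num)

lemma epsSq_eq (k : ℕ) : epsSq n k = 1 ∨ epsSq n k = -1 := by
  unfold epsSq
  split_ifs <;> simp

open Classical in
lemma adOp_serreOperators {M : ℕ} (hM : m + n = M + 1) (hm : 1 ≤ m) (hn : 1 ≤ n) :
    SerreOperators M n (adOp m n) (Pi.single (uw 0) (cp m n 0)) where
  comm i j f h1 h2 h3 :=
    adOp_comm (by omega) (by omega) (by omega) (by rw [Bmat_comm, Bmat_of_far h2 (by omega)]) f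
  odd f := adOp_odd_sq hm hn f
  up i h1 h2 h3 := by
    obtain ⟨i, rfl⟩ : ∃ k, i = k + 1 := ⟨i - 1, by omega⟩
    obtain ⟨hp, hr⟩ := qcf_self_neighbour (m := m) (n := n) (i := i + 1) (j := i + 1 + 1)
      (by omega) (by omega) (epsSq_eq i) (Bmat_self (by omega) h3)
      (by rw [Bmat_comm, Bmat_succ (by omega) (by omega), epsSq_succ h3]) h3
    obtain ⟨ha, hb, -⟩ := quantum_two_ne hr
    exact ⟨_, ha, hb, adOp_quadratic hp (cp_serre_up (by omega) h3)⟩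
  down i h1 h2 h3 := by
    obtain ⟨hp, hr⟩ := qcf_self_neighbour (m := m) (n := n) (i := i + 1) (j := i)
      (by omega) (by omega) (epsSq_eq i) (Bmat_self (by omega) h3)
      (Bmat_succ h1 (by omega)) h3
    exact ⟨_, (quantum_two_ne hr).1, adOp_quadratic hp (cp_serre_down h1 (by omega) h3)⟩
  cubic := by
    have e : epsSq n M = 1 := by simp [epsSq]; omega
    have hr : qcf m n (uw (M + 1)) (uw M) = vv ^ 2 := by
      rw [qcf_uw (by omega) (by omega) (by omega), Bmat_succ (by omega) (by omega), e]
      norm_num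
    have hp : qcf m n (uw (M + 1)) (uw (M + 1)) * qcf m n (uw (M + 1)) (uw M) = 1 := by
      rw [hr, qcf_uw (by omega) (by omega) (by omega), Bmat_last hm hM.symm]
      have := vv_ne_zero
      simp [zpow_neg]
      field_simp
    exact ⟨_, (quantum_two_ne (Or.inl hr)).2.2, adOp_cubic hp (cp_serre_cubic (Or.inr hM.symm))⟩
  quartic k h1 h2 := ⟨_, adOp_quartic hm h1 h2⟩
  lowest i h1 h2 := by
    have h0 : Bmat m n i 0 = 0 := Bmat_of_far (by omega) (by omega)
    rw [adOp_single, qcf_uw (by omega) (by omega) (by omega), h0, qcomm, mul_zero, zpow_zero,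
      one_smul, cp_comm (by omega) (by omega) (by omega) h0, sub_self, Pi.single_zero]
  cubic_lowest := by
    rw [adOp_single, adOp_single, adOp_single, qcf_add_right, qcf_add_right,
      cp_serre_cubic (Or.inl rfl), Pi.single_zero]

open Classical in
lemma foldr_adOp (l : List ℕ) :
    l.foldr (fun i f => adOp m n i f) (Pi.single (uw 0) (cp m n 0))
      = Pi.single (lwt (l ++ [0])) (qfoldr m n (cp m n) (l ++ [0])) := by
  induction l with
  | nil => simp [lwt, qfoldr]
  | cons a l ih =>
    rw [List.foldr_cons, ih, adOp_single]
    cases l <;> rfl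

lemma range'_one_split {N j : ℕ} (hj : 1 ≤ j) (hjN : j ≤ N) :
    List.range' 1 N = List.range' 1 (j - 1) ++ j :: List.range' (j + 1) (N - j) := by
  obtain ⟨j, rfl⟩ : ∃ k, j = k + 1 := ⟨j - 1, by omega⟩
  obtain ⟨d, rfl⟩ := Nat.exists_eq_add_of_le hjN
  rw [← List.range'_succ, show j + 1 + d - (j + 1) + 1 = d + 1 by omega, Nat.add_sub_cancel,
    show j + 1 = 1 + j by omega, List.range'_append_1, show 1 + j + d = j + (d + 1) by omega]

lemma eseq_eq {j : ℕ} (hj : 1 ≤ j) (hjN : j ≤ m + n) :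
    eseq m n j = List.range' 1 (j - 1) ++ List.range' (j + 1) (m + n - j) ++
      (List.range' 1 (m + n)).reverse ++ [0] := by
  have h : (List.range (m + n)).map (· + 1) = List.range' 1 (m + n) := by
    rw [List.range'_eq_map_range]
    exact List.map_congr_left fun k _ => add_comm k 1
  have hf : (List.range' 1 (m + n)).filter (fun k => decide (k ≠ j))
      = List.range' 1 (j - 1) ++ List.range' (j + 1) (m + n - j) := by
    rw [range'_one_split hj hjN, List.filter_append, List.filter_cons_of_neg (by simp),
      List.filter_eq_self.mpr, List.filter_eq_self.mpr]
    all_goals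
      intro k hk
      rw [List.mem_range'_1] at hk
      simp
      omega
  rw [eseq, h, hf]

lemma foldr_reverse_range' {K V : Type*} [Field K] [AddCommGroup V] [Module K V]
    (L : ℕ → Module.End K V) (v : V) (k : ℕ) :
    (List.range' 1 k).reverse.foldr (fun i x => L i x) v = SerreOperators.rise L v k := by
  induction k with
  | zero => rfl
  | succ k ih =>
    rw [List.range'_1_concat, List.reverse_append, List.reverse_singleton, List.singleton_append,
      List.foldr_cons, ih, add_comm 1 k, SerreOperators.rise]

lemma qcomm_root_vector (hm : 1 ≤ m) (hn : 1 ≤ n) {i j : ℕ} (hi1 : 1 ≤ i) (hiN : i ≤ m + n)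
    (hj1 : 1 ≤ j) (hjN : j ≤ m + n) (hij : i ≠ j) :
    qcomm (qcf m n (uw i) (lwt (eseq m n j))) (cp m n i) (EE m n j) = 0 := by
  classical
  obtain ⟨M, hM⟩ : ∃ M, m + n = M + 1 := ⟨m + n - 1, by omega⟩
  have h := (adOp_serreOperators hM hm hn).apply_omit (by omega) hi1 (by omega) hj1 (by omega) hij
  rw [SerreOperators.descend, ← foldr_reverse_range', ← List.foldr_append, ← List.foldr_append,
    show M + 1 + 1 - (j + 1) = m + n - j by omega, ← hM, foldr_adOp, ← eseq_eq hj1 hjN,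
    adOp_single, Pi.single_eq_zero_iff] at h
  exact h

lemma lwt_append (l l' : List ℕ) : lwt (l ++ l') = lwt l + lwt l' := by
  induction l with
  | nil => simp [lwt]
  | cons a l ih =>
    change uw a + lwt (l ++ l') = uw a + lwt l + lwt l'
    rw [ih, add_assoc]

lemma lwt_reverse (l : List ℕ) : lwt l.reverse = lwt l := by
  induction l with
  | nil => rfl
  | cons a l ih =>
    rw [List.reverse_cons, lwt_append, ih, add_comm]
    simp [lwt]

lemma lwt_eseq {j : ℕ} (hj : 1 ≤ j) (hjN : j ≤ m + n) :
    uw j + lwt (eseq m n j)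
      = lwt (List.range' 1 (m + n)) + lwt (List.range' 1 (m + n)) + uw 0 := by
  have h0 : lwt [0] = uw 0 := add_zero _
  have h : lwt (List.range' 1 (m + n))
      = uw j + (lwt (List.range' 1 (j - 1)) + lwt (List.range' (j + 1) (m + n - j))) := by
    rw [range'_one_split hj hjN, lwt_append]
    change _ + (uw j + _) = _
    abel
  rw [eseq_eq hj hjN, lwt_append, lwt_append, lwt_append, lwt_reverse, h0]
  nth_rw 2 [h]
  abel

lemma Bw_lwt_range' {i : ℕ} (hi : i ≤ m + n) {k : ℕ} (hk : k ≤ m + n) :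
    Bw m n (uw i) (lwt (List.range' 1 k)) = ∑ l ∈ range (m + n),
      epsSq n l * co m n i l * ((if 0 = l then 1 else 0) - if k = l then 1 else 0) := by
  induction k with
  | zero => simp [lwt, Bw]
  | succ k ih =>
    rw [List.range'_1_concat, lwt_append, Bw_add_right, ih (by omega), add_comm 1 k,
      show lwt [k + 1] = uw (k + 1) from add_zero _, Bw_uw hi hk, Bmat, ← sum_add_distrib]
    refine sum_congr rfl fun l hl => ?_
    rw [co_eq (i := k + 1) (by omega) (mem_range.mp hl)]
    simp only [Nat.add_right_cancel_iff]
    ring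

lemma qcf_delta (hn : 1 ≤ n) {i : ℕ} (hi : i ≤ m + n) :
    qcf m n (uw i) (lwt (List.range' 1 (m + n)) + lwt (List.range' 1 (m + n)) + uw 0) = 1 := by
  have hB : Bw m n (uw i) (lwt (List.range' 1 (m + n)) + lwt (List.range' 1 (m + n)) + uw 0)
      = 0 := by
    rw [Bw_add_right, Bw_add_right, Bw_lwt_range' hi le_rfl, Bw_uw hi (by omega), Bmat,
      ← sum_add_distrib, ← sum_add_distrib]
    refine sum_eq_zero fun l hl => ?_
    have := mem_range.mp hl
    rw [if_neg (show ¬m + n = l by omega), show co m n 0 l = if l = 0 then -2 else 0 from if_pos rfl]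
    split_ifs <;> omega
  rw [qcf, hB, sg, Pi.add_apply, show uw 0 n = 0 by simp [uw]; omega, Pi.add_apply]
  rw [mul_zero, zpow_zero, mul_one, add_zero, ← two_mul, mul_left_comm]
  exact (even_two_mul _).neg_one_zpow

lemma qcf_lwt_eseq (hn : 1 ≤ n) {i j : ℕ} (hi : i ≤ m + n) (hj1 : 1 ≤ j) (hjN : j ≤ m + n)
    (hij : i ≠ j) : qcf m n (uw i) (lwt (eseq m n j)) = vv ^ (2 * Bmat m n i j) := by
  have h := qcf_delta (m := m) hn hi
  rw [← lwt_eseq hj1 hjN, qcf_add_right, qcf_uw hi hjN (by omega)] at h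
  rw [eq_inv_of_mul_eq_one_right h, ← zpow_neg, neg_mul, neg_neg]

lemma kiU_mul_kU {i : ℕ} (hi : i ≤ m + n) : kiU m n i * kU m n i = 1 := by
  simpa [kU, kiU] using mkU_rel (URel.inv_k i hi)

lemma kU_mul_cp {i j : ℕ} (hi : i ≤ m + n) (hj : j ≤ m + n) :
    kU m n i * cp m n j = vv ^ (2 * Bmat m n i j) • (cp m n j * kU m n i) := by
  have h : kU m n i * cp m n j * kiU m n i = vv ^ (2 * Bmat m n i j) • cp m n j := by
    simpa [kU, kiU, cp, fx] using mkU_rel (URel.k_x true i j hi hj)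
  rw [← smul_mul_assoc, ← h, mul_assoc _ (kiU m n i), kiU_mul_kU hi, mul_one]

lemma cp_comm_root_vector (hm : 1 ≤ m) (hn : 1 ≤ n) {i j : ℕ} (hi1 : 1 ≤ i) (hiN : i ≤ m + n)
    (hj1 : 1 ≤ j) (hjN : j ≤ m + n) (hij : i ≠ j) :
    cp m n i * (kU m n j * EE m n j) = kU m n j * EE m n j * cp m n i := by
  have h := qcomm_root_vector hm hn hi1 hiN hj1 hjN hij
  rw [qcf_lwt_eseq hn hiN hj1 hjN hij, qcomm, sub_eq_zero] at h
  have hk := kU_mul_cp hjN hiN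
  rw [Bmat_comm] at hk
  have hv : vv ^ (2 * Bmat m n i j) ≠ 0 := zpow_ne_zero _ vv_ne_zero
  apply smul_right_injective _ hv
  simp only
  rw [← mul_assoc, ← smul_mul_assoc, ← hk, mul_assoc, h, mul_smul_comm, mul_assoc]

lemma cm_comm_root_vector {τ : KK →+* KK} {Ω : UAlg m n → UAlg m n} (hΩ : OmegaSpec m n τ Ω)
    {i j : ℕ} (hi : i ≤ m + n) (hj : j ≤ m + n)
    (h : cp m n i * (kU m n j * EE m n j) = kU m n j * EE m n j * cp m n i) :
    cm m n i * (Ω (EE m n j) * kiU m n j) = Ω (EE m n j) * kiU m n j * cm m n i := by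
  obtain ⟨-, -, -, -, hmul, -, hcp, -, hk, -⟩ := hΩ
  have h' := congrArg Ω h
  rw [hmul, hmul, hmul, hcp i hi, hk j hj, hmul, hk j hj, mul_smul_comm, smul_mul_assoc] at h'
  have hd : ((dd n (i + 1) : ℤ) : KK) ≠ 0 := by
    unfold dd
    split_ifs <;> simp
  exact (smul_right_injective _ hd h').symm

end adjoint

/-- in `U`, for `1 ≤ i, j ≤ N` with `i ≠ j`,
`χ_i⁺ (K_j 𝓔_j) = (-1)^{[α_i][α_j]} (K_j 𝓔_j) χ_i⁺` and
`χ_i⁻ (Ω(𝓔_j) K_j⁻¹) = (-1)^{[α_i][α_j]} (Ω(𝓔_j) K_j⁻¹) χ_i⁻`. -/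
theorem chi_supercommutes_with_root_vector (m n : ℕ) (hm : 1 ≤ m) (hn : 1 ≤ n)
    (τ : KK →+* KK) (Ω : UAlg m n → UAlg m n) (hΩ : OmegaSpec m n τ Ω)
    (i j : ℕ) (hi1 : 1 ≤ i) (hiN : i ≤ m + n) (hj1 : 1 ≤ j) (hjN : j ≤ m + n)
    (hij : i ≠ j) :
    cp m n i * (kU m n j * EE m n j)
      = sg n (uw i) (uw j) • ((kU m n j * EE m n j) * cp m n i) ∧
    cm m n i * (Ω (EE m n j) * kiU m n j)
      = sg n (uw i) (uw j) • ((Ω (EE m n j) * kiU m n j) * cm m n i) := by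
  have h := cp_comm_root_vector hm hn hi1 hiN hj1 hjN hij
  rw [sg_uw (by omega), one_smul, one_smul]
  exact ⟨h, cm_comm_root_vector hΩ hiN hjN h⟩
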